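/- arXiv:2202.02289 — 2 statements merged into one kernel-verified Lean document; each statement's English description precedes it below -/
import Mathlib

section
/- For each fixed h ∈ (0,1) there exists ε₀ > 0 such that for all ε ∈ (0, ε₀]: ∫_{x²+y²≤h²} (x²+y²) dν_ε(x,y) = 1 and ∫_{x²+y²≤h²} x² dν_ε(x,y) = ∫_{x²+y²≤h²} y² dν_ε(x,y) = 1/2. -/
open MeasureTheory Filter Set
open scoped ENNReal NNReal Topology

noncomputable def C0 (α : ℝ) : ℝ :=
  (∑' k : ℕ, (((k : ℝ) + 2) - 1) * (((k : ℝ) + 2) - 2) / (2 * ((k : ℝ) + 2) ^ (α + 2)))⁻¹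

noncomputable def C1 (α : ℝ) : ℝ :=
  C0 α * (1 + C0 α * ∑' k : ℕ, (((k : ℝ) + 2) - 1) * ((k : ℝ) + 2) ^ (-α - 2))⁻¹

/-- The measure `ν` on `ℝ²` with density `C₁ 1_{x<0} 1_{y>0} (-x+y)^{-α-2}`. -/
noncomputable def nuMeas (α : ℝ) : Measure (ℝ × ℝ) :=
  (volume : Measure (ℝ × ℝ)).withDensity fun z =>
    if z.1 < 0 ∧ 0 < z.2 then ENNReal.ofReal (C1 α * (-z.1 + z.2) ^ (-α - 2)) else 0

/-- `σ(ε)² = ∫_{x²+y²≤ε²} (x²+y²) dν(x,y)` (as an extended real). -/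
noncomputable def sigmaSq (α ε : ℝ) : ℝ≥0∞ :=
  ∫⁻ z in {z : ℝ × ℝ | z.1 ^ 2 + z.2 ^ 2 ≤ ε ^ 2},
    ENNReal.ofReal (z.1 ^ 2 + z.2 ^ 2) ∂(nuMeas α)

/-- `σ(ε)`. -/
noncomputable def sigmaEps (α ε : ℝ) : ℝ := Real.sqrt (sigmaSq α ε).toReal

/-- The measure `ν_ε` on `ℝ²` with density
`C₁ 1_{x<0} 1_{y>0} 1_{x²+y² ≤ ε²/σ(ε)²} σ(ε)^{-α} (-x+y)^{-α-2}`. -/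
noncomputable def nuEps (α ε : ℝ) : Measure (ℝ × ℝ) :=
  (volume : Measure (ℝ × ℝ)).withDensity fun z =>
    if z.1 < 0 ∧ 0 < z.2 ∧ z.1 ^ 2 + z.2 ^ 2 ≤ ε ^ 2 / sigmaEps α ε ^ 2 then
      ENNReal.ofReal (C1 α * sigmaEps α ε ^ (-α) * (-z.1 + z.2) ^ (-α - 2))
    else 0

/-- The integral of `f` over the part of the second quadrant within distance `ρ` of the origin,
against the density `(-x+y)^{-α-2}`. -/
noncomputable def quadrantMoment (α ρ : ℝ) (f : ℝ × ℝ → ℝ) : ℝ≥0∞ :=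
  ∫⁻ z : ℝ × ℝ, if z.1 < 0 ∧ 0 < z.2 ∧ z.1 ^ 2 + z.2 ^ 2 ≤ ρ ^ 2 then
    ENNReal.ofReal (f z * (-z.1 + z.2) ^ (-α - 2)) else 0

lemma C0_pos {α : ℝ} (hα : 1 < α) : 0 < C0 α := by
  unfold C0
  have hnonneg : ∀ k : ℕ,
      0 ≤ (((k : ℝ) + 2) - 1) * (((k : ℝ) + 2) - 2) / (2 * ((k : ℝ) + 2) ^ (α + 2)) := by
    intro k
    have hk : (0 : ℝ) ≤ k := k.cast_nonneg
    have h1 : (0 : ℝ) ≤ ((k : ℝ) + 2) - 1 := by linarith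
    have h2 : (0 : ℝ) ≤ ((k : ℝ) + 2) - 2 := by linarith
    positivity
  have hsum : Summable fun k : ℕ =>
      (((k : ℝ) + 2) - 1) * (((k : ℝ) + 2) - 2) / (2 * ((k : ℝ) + 2) ^ (α + 2)) := by
    have h1 : Summable fun k : ℕ => ((k + 2 : ℕ) : ℝ) ^ (-α) :=
      (summable_nat_add_iff (f := fun n : ℕ => (n : ℝ) ^ (-α)) 2).2
        (Real.summable_nat_rpow.2 (by linarith))
    refine Summable.of_nonneg_of_le hnonneg (fun k => ?_) h1
    have hk : (0 : ℝ) ≤ k := k.cast_nonneg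
    have hk2 : (0 : ℝ) < (k : ℝ) + 2 := by linarith
    push_cast
    rw [Real.rpow_neg hk2.le, Real.rpow_add hk2, Real.rpow_two, div_le_iff₀ (by positivity)]
    have hp : 0 < ((k : ℝ) + 2) ^ α := by positivity
    have : (((k : ℝ) + 2) ^ α)⁻¹ * (2 * (((k : ℝ) + 2) ^ α * ((k : ℝ) + 2) ^ 2))
        = 2 * ((k : ℝ) + 2) ^ 2 := by field_simp
    rw [this]
    nlinarith
  refine inv_pos.2 (hsum.tsum_pos hnonneg 1 ?_)
  norm_num
  positivity

lemma C1_pos {α : ℝ} (hα : 1 < α) : 0 < C1 α := by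
  unfold C1
  have h0 := C0_pos hα
  have h1 : 0 ≤ ∑' k : ℕ, (((k : ℝ) + 2) - 1) * ((k : ℝ) + 2) ^ (-α - 2) := by
    refine tsum_nonneg fun k => ?_
    have hk : (0 : ℝ) ≤ ((k : ℝ) + 2) - 1 := by
      have : (0 : ℝ) ≤ k := k.cast_nonneg
      linarith
    positivity
  positivity

lemma measurableSet_quadrant_disc (R : ℝ) :
    MeasurableSet {z : ℝ × ℝ | z.1 < 0 ∧ 0 < z.2 ∧ z.1 ^ 2 + z.2 ^ 2 ≤ R} := by
  have hd : MeasurableSet {z : ℝ × ℝ | z.1 ^ 2 + z.2 ^ 2 ≤ R} :=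
    measurableSet_le (by fun_prop) measurable_const
  exact (measurableSet_lt measurable_fst measurable_const).inter
    ((measurableSet_lt measurable_const measurable_snd).inter hd)

lemma measurable_quadrant_density (α R : ℝ) {f : ℝ × ℝ → ℝ} (hf : Measurable f) :
    Measurable fun z : ℝ × ℝ => if z.1 < 0 ∧ 0 < z.2 ∧ z.1 ^ 2 + z.2 ^ 2 ≤ R then
      ENNReal.ofReal (f z * (-z.1 + z.2) ^ (-α - 2)) else 0 :=
  Measurable.ite (measurableSet_quadrant_disc R) (by fun_prop) measurable_const

lemma sigmaSq_eq {α : ℝ} (hα : 1 < α) (ε : ℝ) :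
    sigmaSq α ε = ENNReal.ofReal (C1 α) *
      quadrantMoment α ε (fun z => z.1 ^ 2 + z.2 ^ 2) := by
  have hd : MeasurableSet {z : ℝ × ℝ | z.1 ^ 2 + z.2 ^ 2 ≤ ε ^ 2} :=
    measurableSet_le (by fun_prop) measurable_const
  have hq : MeasurableSet {z : ℝ × ℝ | z.1 < 0 ∧ 0 < z.2} :=
    (measurableSet_lt measurable_fst measurable_const).inter
      (measurableSet_lt measurable_const measurable_snd)
  unfold sigmaSq nuMeas quadrantMoment
  rw [setLIntegral_withDensity_eq_setLIntegral_mul _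
      (Measurable.ite hq (by fun_prop) measurable_const) (by fun_prop) hd,
    ← lintegral_indicator hd, ← lintegral_const_mul _ (measurable_quadrant_density _ _ (by fun_prop))]
  refine lintegral_congr fun z => ?_
  simp only [Set.indicator_apply, Set.mem_ofPred_eq, Pi.mul_apply]
  by_cases h1 : z.1 ^ 2 + z.2 ^ 2 ≤ ε ^ 2
  · by_cases h2 : z.1 < 0 ∧ 0 < z.2
    · have h3 : z.1 < 0 ∧ 0 < z.2 ∧ z.1 ^ 2 + z.2 ^ 2 ≤ ε ^ 2 := ⟨h2.1, h2.2, h1⟩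
      rw [if_pos h1, if_pos h2, if_pos h3, ← ENNReal.ofReal_mul' (by positivity),
        ← ENNReal.ofReal_mul (C1_pos hα).le]
      congr 1
      ring
    · rw [if_pos h1, if_neg h2, if_neg fun h => h2 ⟨h.1, h.2.1⟩, zero_mul, mul_zero]
  · rw [if_neg h1, if_neg fun h => h1 h.2.2, mul_zero]

lemma setLIntegral_nuEps {α ε h : ℝ} (hα : 1 < α)
    (hle : (ε / sigmaEps α ε) ^ 2 ≤ h ^ 2) {f : ℝ × ℝ → ℝ} (hf : Measurable f)
    (hf0 : ∀ z, 0 ≤ f z) :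
    (∫⁻ z in {z : ℝ × ℝ | z.1 ^ 2 + z.2 ^ 2 ≤ h ^ 2}, ENNReal.ofReal (f z) ∂(nuEps α ε)) =
      ENNReal.ofReal (C1 α * sigmaEps α ε ^ (-α)) * quadrantMoment α (ε / sigmaEps α ε) f := by
  have hd : MeasurableSet {z : ℝ × ℝ | z.1 ^ 2 + z.2 ^ 2 ≤ h ^ 2} :=
    measurableSet_le (by fun_prop) measurable_const
  have hc : 0 ≤ C1 α * sigmaEps α ε ^ (-α) :=
    mul_nonneg (C1_pos hα).le (Real.rpow_nonneg (Real.sqrt_nonneg _) _)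
  unfold nuEps quadrantMoment
  simp only [← div_pow]
  rw [setLIntegral_withDensity_eq_setLIntegral_mul _
      (Measurable.ite (measurableSet_quadrant_disc _) (by fun_prop) measurable_const)
      (by fun_prop) hd,
    ← lintegral_indicator hd, ← lintegral_const_mul _ (measurable_quadrant_density _ _ hf)]
  refine lintegral_congr fun z => ?_
  simp only [Set.indicator_apply, Set.mem_ofPred_eq, Pi.mul_apply]
  by_cases h2 : z.1 < 0 ∧ 0 < z.2 ∧ z.1 ^ 2 + z.2 ^ 2 ≤ (ε / sigmaEps α ε) ^ 2
  · rw [if_pos (h2.2.2.trans hle), if_pos h2, if_pos h2, ← ENNReal.ofReal_mul' (hf0 z),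
      ← ENNReal.ofReal_mul hc]
    congr 1
    ring
  · rw [if_neg h2, if_neg h2]
    simp

lemma quadrantMoment_scale (α : ℝ) {ρ : ℝ} (hρ : 0 < ρ) :
    quadrantMoment α ρ (fun z => z.1 ^ 2 + z.2 ^ 2) =
      ENNReal.ofReal (ρ ^ (2 - α)) * quadrantMoment α 1 (fun z => z.1 ^ 2 + z.2 ^ 2) := by
  have hmap : Measure.map (fun z : ℝ × ℝ => ρ⁻¹ • z) volume =
      ENNReal.ofReal (ρ ^ 2) • (volume : Measure (ℝ × ℝ)) := by
    rw [Measure.map_addHaar_smul (volume : Measure (ℝ × ℝ)) (inv_ne_zero hρ.ne')]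
    simp [abs_of_pos hρ]
  have hm1 := measurable_quadrant_density α (1 ^ 2)
    (f := fun z => z.1 ^ 2 + z.2 ^ 2) (by fun_prop)
  have key : ∀ z : ℝ × ℝ,
      (if z.1 < 0 ∧ 0 < z.2 ∧ z.1 ^ 2 + z.2 ^ 2 ≤ ρ ^ 2 then
        ENNReal.ofReal ((z.1 ^ 2 + z.2 ^ 2) * (-z.1 + z.2) ^ (-α - 2)) else 0) =
      ENNReal.ofReal (ρ ^ (-α)) * (fun z : ℝ × ℝ =>
        if z.1 < 0 ∧ 0 < z.2 ∧ z.1 ^ 2 + z.2 ^ 2 ≤ 1 ^ 2 then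
        ENNReal.ofReal ((z.1 ^ 2 + z.2 ^ 2) * (-z.1 + z.2) ^ (-α - 2)) else 0) (ρ⁻¹ • z) := by
    intro z
    have e1 : ρ⁻¹ * z.1 < 0 ↔ z.1 < 0 := smul_neg_iff_of_pos_left (inv_pos.2 hρ)
    have e2 : 0 < ρ⁻¹ * z.2 ↔ 0 < z.2 := mul_pos_iff_of_pos_left (inv_pos.2 hρ)
    have e3 : (ρ⁻¹ * z.1) ^ 2 + (ρ⁻¹ * z.2) ^ 2 ≤ 1 ^ 2 ↔ z.1 ^ 2 + z.2 ^ 2 ≤ ρ ^ 2 := by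
      have : (ρ⁻¹ * z.1) ^ 2 + (ρ⁻¹ * z.2) ^ 2 = (z.1 ^ 2 + z.2 ^ 2) / ρ ^ 2 := by
        field_simp
      rw [this, one_pow, div_le_one (by positivity)]
    simp only [Prod.smul_fst, Prod.smul_snd, smul_eq_mul, e1, e2, e3]
    split_ifs with hz
    · rw [← ENNReal.ofReal_mul (by positivity)]
      congr 1
      have hpos : 0 < -z.1 + z.2 := by linarith [hz.1, hz.2.1]
      have e4 : -(ρ⁻¹ * z.1) + ρ⁻¹ * z.2 = ρ⁻¹ * (-z.1 + z.2) := by ring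
      rw [e4, Real.mul_rpow (by positivity) hpos.le, Real.inv_rpow hρ.le,
        ← Real.rpow_neg hρ.le, show -(-α - 2) = α + 2 by ring, Real.rpow_add hρ,
        Real.rpow_neg hρ.le, Real.rpow_two]
      field_simp
    · simp
  unfold quadrantMoment
  rw [lintegral_congr key, lintegral_const_mul' _ _ ENNReal.ofReal_ne_top,
    ← lintegral_map hm1 (measurable_const_smul _), hmap, lintegral_smul_measure, smul_eq_mul,
    ← mul_assoc, ← ENNReal.ofReal_mul (by positivity)]
  congr 2
  rw [show 2 - α = -α + 2 by ring, Real.rpow_add hρ, Real.rpow_two]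

lemma quadrantMoment_fst_eq_snd (α ρ : ℝ) :
    quadrantMoment α ρ (fun z => z.1 ^ 2) = quadrantMoment α ρ (fun z => z.2 ^ 2) := by
  have hmp : MeasurePreserving (fun z : ℝ × ℝ => -z.swap) volume volume :=
    (Measure.measurePreserving_neg (volume : Measure (ℝ × ℝ))).comp Measure.measurePreserving_swap
  unfold quadrantMoment
  rw [← hmp.lintegral_comp (measurable_quadrant_density α (ρ ^ 2) (by fun_prop))]
  refine lintegral_congr fun z => ?_
  simp only [Prod.fst_neg, Prod.snd_neg, Prod.fst_swap, Prod.snd_swap, neg_sq, neg_lt_zero,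
    neg_pos, neg_neg]
  rw [add_comm (z.2 ^ 2), add_comm z.2]
  simp only [and_left_comm]

lemma quadrantMoment_add (α ρ : ℝ) :
    quadrantMoment α ρ (fun z => z.1 ^ 2 + z.2 ^ 2) =
      quadrantMoment α ρ (fun z => z.1 ^ 2) + quadrantMoment α ρ (fun z => z.2 ^ 2) := by
  unfold quadrantMoment
  rw [← lintegral_add_left (measurable_quadrant_density α (ρ ^ 2) (by fun_prop))]
  refine lintegral_congr fun z => ?_
  split_ifs with hz
  · have hpos : 0 < -z.1 + z.2 := by linarith [hz.1, hz.2.1]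
    rw [← ENNReal.ofReal_add (by positivity) (by positivity), add_mul]
  · simp

lemma quadrantMoment_pos (α : ℝ) :
    0 < quadrantMoment α 1 (fun z => z.1 ^ 2 + z.2 ^ 2) := by
  unfold quadrantMoment
  rw [lintegral_pos_iff_support (measurable_quadrant_density α (1 ^ 2) (by fun_prop))]
  have hopen : IsOpen (Ioo (-1 / 2 : ℝ) 0 ×ˢ Ioo (0 : ℝ) (1 / 2)) := isOpen_Ioo.prod isOpen_Ioo
  refine (hopen.measure_pos volume ⟨(-1 / 4, 1 / 4), by norm_num⟩).trans_le (measure_mono ?_)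
  rintro ⟨x, y⟩ ⟨⟨hx1, hx2⟩, hy1, hy2⟩
  dsimp only at hx1 hx2 hy1 hy2
  have hc : x < 0 ∧ 0 < y ∧ x ^ 2 + y ^ 2 ≤ 1 ^ 2 := ⟨hx2, hy1, by nlinarith⟩
  have hpos : 0 < -x + y := by linarith
  simp only [Function.mem_support, if_pos hc]
  exact (ENNReal.ofReal_pos.2 (by positivity)).ne'

lemma rpow_add_le_mul_rpow {s t p : ℝ} (hs : 0 < s) (ht : 0 < t) (hp : 0 ≤ p) :
    (s + t) ^ (-p) ≤ s ^ (-(p / 2)) * t ^ (-(p / 2)) := by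
  have h1 : (s + t) ^ (-p) = ((s + t) ^ 2) ^ (-(p / 2)) := by
    rw [← Real.rpow_natCast (s + t) 2, ← Real.rpow_mul (by positivity)]
    congr 1
    push_cast
    ring
  rw [h1, ← Real.mul_rpow hs.le ht.le]
  exact Real.rpow_le_rpow_of_nonpos (by positivity) (by nlinarith) (by linarith)

lemma setLIntegral_Ioc_rpow_lt_top {r : ℝ} (hr : -1 < r) :
    ∫⁻ t in Ioc (0 : ℝ) 1, ENNReal.ofReal (t ^ r) < ∞ := by
  have h := (intervalIntegral.intervalIntegrable_rpow' (a := 0) (b := 1) hr).1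
  exact h.lintegral_lt_top

lemma quadrantMoment_lt_top {α : ℝ} (hα0 : 0 ≤ α) (hα : α < 2) :
    quadrantMoment α 1 (fun z => z.1 ^ 2 + z.2 ^ 2) < ∞ := by
  set g : ℝ → ℝ≥0∞ := (Ioc (0 : ℝ) 1).indicator fun t => ENNReal.ofReal (t ^ (-(α / 2))) with hg
  have hgm : Measurable g := Measurable.indicator (by fun_prop) measurableSet_Ioc
  have hgi : ∫⁻ t, g t < ∞ := by
    rw [hg, lintegral_indicator measurableSet_Ioc]
    exact setLIntegral_Ioc_rpow_lt_top (by linarith)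
  have hbound : quadrantMoment α 1 (fun z => z.1 ^ 2 + z.2 ^ 2) ≤
      ∫⁻ z : ℝ × ℝ, g (-z.1) * g z.2 := by
    refine lintegral_mono fun z => ?_
    dsimp only
    split_ifs with hz
    · obtain ⟨hx, hy, hr⟩ := hz
      have h1 : -z.1 ∈ Ioc (0 : ℝ) 1 := ⟨by linarith, by nlinarith⟩
      have h2 : z.2 ∈ Ioc (0 : ℝ) 1 := ⟨hy, by nlinarith⟩
      have hs : 0 < -z.1 := h1.1
      have hpos : 0 < -z.1 + z.2 := by linarith
      rw [hg, Set.indicator_of_mem h1, Set.indicator_of_mem h2,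
        ← ENNReal.ofReal_mul (by positivity)]
      refine ENNReal.ofReal_le_ofReal ((?_ : _ ≤ (-z.1 + z.2) ^ (-α)).trans
        (rpow_add_le_mul_rpow hs hy hα0))
      have h3 : (-z.1 + z.2) ^ (-α) = (-z.1 + z.2) ^ 2 * (-z.1 + z.2) ^ (-α - 2) := by
        rw [← Real.rpow_two, ← Real.rpow_add hpos]
        congr 1
        ring
      rw [h3]
      gcongr
      nlinarith
    · exact zero_le
  refine hbound.trans_lt ?_
  rw [Measure.volume_eq_prod, lintegral_prod_mul (f := fun x => g (-x)) (by fun_prop) (by fun_prop),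
    lintegral_neg_eq_self]
  exact ENNReal.mul_lt_top hgi hgi

/-- For each fixed `h ∈ (0,1)` there exists `ε₀ > 0` such that for all
`ε ∈ (0, ε₀]`: `∫_{x²+y²≤h²} (x²+y²) dν_ε = 1` and
`∫_{x²+y²≤h²} x² dν_ε = ∫_{x²+y²≤h²} y² dν_ε = 1/2`. -/
theorem stmt10 (α : ℝ) (hα1 : 1 < α) (hα2 : α < 2) (h : ℝ) (hh0 : 0 < h) (hh1 : h < 1) :
    ∃ ε₀ : ℝ, 0 < ε₀ ∧ ∀ ε : ℝ, 0 < ε → ε ≤ ε₀ →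
      (∫⁻ z in {z : ℝ × ℝ | z.1 ^ 2 + z.2 ^ 2 ≤ h ^ 2},
          ENNReal.ofReal (z.1 ^ 2 + z.2 ^ 2) ∂(nuEps α ε)) = 1 ∧
      (∫⁻ z in {z : ℝ × ℝ | z.1 ^ 2 + z.2 ^ 2 ≤ h ^ 2},
          ENNReal.ofReal (z.1 ^ 2) ∂(nuEps α ε)) = 1 / 2 ∧
      (∫⁻ z in {z : ℝ × ℝ | z.1 ^ 2 + z.2 ^ 2 ≤ h ^ 2},
          ENNReal.ofReal (z.2 ^ 2) ∂(nuEps α ε)) = 1 / 2 := by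
  set K := quadrantMoment α 1 (fun z => z.1 ^ 2 + z.2 ^ 2) with hK
  have hKtop : K < ∞ := quadrantMoment_lt_top (by linarith) hα2
  set k := K.toReal with hk
  have hkpos : 0 < k := ENNReal.toReal_pos (quadrantMoment_pos α).ne' hKtop.ne
  have hKk : K = ENNReal.ofReal k := (ENNReal.ofReal_toReal hKtop.ne).symm
  have hc := C1_pos hα1
  refine ⟨(h ^ 2 * (C1 α * k)) ^ (1 / α), by positivity, fun ε hε hεle => ?_⟩
  have hα0 : 0 < α := by linarith
  have hεα : ε ^ α ≤ h ^ 2 * (C1 α * k) := by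
    have := Real.rpow_le_rpow hε.le hεle hα0.le
    rwa [← Real.rpow_mul (by positivity), one_div_mul_cancel hα0.ne', Real.rpow_one] at this
  have hσ : sigmaEps α ε ^ 2 = C1 α * (ε ^ (2 - α) * k) := by
    unfold sigmaEps
    rw [sigmaSq_eq hα1, quadrantMoment_scale α hε, ← hK, hKk, ← ENNReal.ofReal_mul (by positivity),
      ← ENNReal.ofReal_mul hc.le, ENNReal.toReal_ofReal (by positivity),
      Real.sq_sqrt (by positivity)]
  have hσpos : 0 < sigmaEps α ε :=
    lt_of_le_of_ne (Real.sqrt_nonneg _) fun h0 => by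
      rw [← h0] at hσ
      have : 0 < C1 α * (ε ^ (2 - α) * k) := by positivity
      rw [← hσ] at this
      norm_num at this
  have hle : (ε / sigmaEps α ε) ^ 2 ≤ h ^ 2 := by
    rw [div_pow, hσ, div_le_iff₀ (by positivity)]
    have : ε ^ 2 = ε ^ α * ε ^ (2 - α) := by
      rw [← Real.rpow_add hε, ← Real.rpow_two]
      congr 1
      ring
    rw [this]
    nlinarith [mul_le_mul_of_nonneg_right hεα (Real.rpow_nonneg hε.le (2 - α))]
  have htotal : ENNReal.ofReal (C1 α * sigmaEps α ε ^ (-α)) *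
      quadrantMoment α (ε / sigmaEps α ε) (fun z => z.1 ^ 2 + z.2 ^ 2) = 1 := by
    rw [quadrantMoment_scale α (div_pos hε hσpos), ← hK, hKk,
      ← ENNReal.ofReal_mul (by positivity), ← ENNReal.ofReal_mul (by positivity),
      ← ENNReal.ofReal_one]
    congr 1
    have h1 : sigmaEps α ε ^ (2 - α) = sigmaEps α ε ^ (-α) * sigmaEps α ε ^ 2 := by
      rw [← Real.rpow_two, ← Real.rpow_add hσpos]
      congr 1
      ring
    have h2 : 0 < sigmaEps α ε ^ (-α) := by positivity
    have h3 : 0 < ε ^ (2 - α) := by positivity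
    rw [Real.div_rpow hε.le hσpos.le, h1, hσ]
    field_simp
  have hhalf : ENNReal.ofReal (C1 α * sigmaEps α ε ^ (-α)) *
      quadrantMoment α (ε / sigmaEps α ε) (fun z => z.2 ^ 2) = 1 / 2 := by
    rw [quadrantMoment_add, quadrantMoment_fst_eq_snd, ← two_mul, mul_left_comm] at htotal
    rw [ENNReal.eq_div_iff (by norm_num) (by norm_num), htotal]
  refine ⟨?_, ?_, ?_⟩
  · rw [setLIntegral_nuEps hα1 hle (by fun_prop) fun z => by positivity, htotal]
  · rw [setLIntegral_nuEps hα1 hle (by fun_prop) fun z => by positivity,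
      quadrantMoment_fst_eq_snd, hhalf]
  · rw [setLIntegral_nuEps hα1 hle (by fun_prop) fun z => by positivity, hhalf]
end

section
/- For each fixed h ∈ (0,1), the limit r = lim_{ε→0} ∫_{x²+y²≤h²} x y dν_ε(x,y) exists and satisfies −1/2 ≤ r ≤ 0. -/
open MeasureTheory Filter Set
open scoped ENNReal NNReal Topology

/-- The closed disc in `ℝ × ℝ` of squared radius `ρ` around the origin. -/
def sqDisc (ρ : ℝ) : Set (ℝ × ℝ) := {z | z.1 ^ 2 + z.2 ^ 2 ≤ ρ}

/-- The homogeneous kernel `1_{x<0} 1_{y>0} (-x+y)^{-α-2}`. -/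
noncomputable def quadrantKernel (α : ℝ) (z : ℝ × ℝ) : ℝ :=
  if z.1 < 0 ∧ 0 < z.2 then (-z.1 + z.2) ^ (-α - 2) else 0

lemma measurableSet_sqDisc (ρ : ℝ) : MeasurableSet (sqDisc ρ) :=
  measurableSet_le (by fun_prop) measurable_const

lemma measurableSet_quadrant : MeasurableSet {z : ℝ × ℝ | z.1 < 0 ∧ 0 < z.2} :=
  (measurableSet_lt measurable_fst measurable_const).inter
    (measurableSet_lt measurable_const measurable_snd)

lemma measurable_quadrantKernel (α : ℝ) : Measurable (quadrantKernel α) :=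
  Measurable.ite measurableSet_quadrant (by fun_prop) measurable_const

lemma quadrantKernel_nonneg (α : ℝ) (z : ℝ × ℝ) : 0 ≤ quadrantKernel α z := by
  unfold quadrantKernel
  split_ifs with hz
  · exact Real.rpow_nonneg (by linarith [hz.1, hz.2]) _
  · exact le_rfl

lemma quadrantKernel_smul (α : ℝ) {R : ℝ} (hR : 0 < R) (z : ℝ × ℝ) :
    quadrantKernel α (R • z) = R ^ (-α - 2) * quadrantKernel α z := by
  simp only [quadrantKernel, Prod.smul_fst, Prod.smul_snd, smul_eq_mul, mul_neg_iff,
    mul_pos_iff, hR, hR.not_gt, true_and, false_and, or_false]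
  split_ifs with hz
  · rw [← Real.mul_rpow hR.le (by linarith [hz.1, hz.2])]
    congr 1
    ring
  · simp

lemma setIntegral_sqDisc_quadrantKernel_mul (α : ℝ) {R : ℝ} (hR : 0 < R) {q : ℝ × ℝ → ℝ}
    (hq : ∀ z, q (R • z) = R ^ 2 * q z) :
    ∫ z in sqDisc (R ^ 2), quadrantKernel α z * q z =
      R ^ (2 - α) * ∫ z in sqDisc 1, quadrantKernel α z * q z := by
  rw [← integral_indicator (measurableSet_sqDisc _), ← integral_indicator (measurableSet_sqDisc _)]
  have hscale := Measure.integral_comp_smul (volume : Measure (ℝ × ℝ))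
    ((sqDisc (R ^ 2)).indicator fun z => quadrantKernel α z * q z) R
  have hpt : ∀ z : ℝ × ℝ,
      (sqDisc (R ^ 2)).indicator (fun z => quadrantKernel α z * q z) (R • z) =
        R ^ (-α) * (sqDisc 1).indicator (fun z => quadrantKernel α z * q z) z := by
    intro z
    have hmem : R • z ∈ sqDisc (R ^ 2) ↔ z ∈ sqDisc 1 := by
      simp only [sqDisc, mem_ofPred_eq, Prod.smul_fst, Prod.smul_snd, smul_eq_mul]
      rw [show (R * z.1) ^ 2 + (R * z.2) ^ 2 = R ^ 2 * (z.1 ^ 2 + z.2 ^ 2) by ring]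
      exact mul_le_iff_le_one_right (by positivity)
    have hpow : R ^ (-α) = R ^ (-α - 2) * R ^ 2 := by
      rw [← Real.rpow_natCast R 2, ← Real.rpow_add hR]
      norm_num
    by_cases hz : z ∈ sqDisc 1
    · rw [indicator_of_mem (hmem.2 hz), indicator_of_mem hz, quadrantKernel_smul α hR, hq, hpow]
      ring
    · rw [indicator_of_notMem (hmem.not.2 hz), indicator_of_notMem hz, mul_zero]
  simp_rw [hpt] at hscale
  rw [integral_const_mul, Module.finrank_prod, Module.finrank_self,
    abs_of_pos (by positivity), smul_eq_mul, eq_inv_mul_iff_mul_eq₀ (by positivity)] at hscale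
  rw [← hscale, ← mul_assoc]
  congr 1
  rw [← Real.rpow_natCast R, ← Real.rpow_add hR]
  norm_num [sub_eq_add_neg]

lemma toReal_sigmaSq {α : ℝ} (hC : 0 < C1 α) {ε : ℝ} (hε : 0 < ε) :
    (sigmaSq α ε).toReal =
      ε ^ (2 - α) * (C1 α * ∫ z in sqDisc 1, quadrantKernel α z * (z.1 ^ 2 + z.2 ^ 2)) := by
  have hdens : nuMeas α = (volume : Measure (ℝ × ℝ)).withDensity
      fun z => ENNReal.ofReal (C1 α * quadrantKernel α z) := by
    unfold nuMeas quadrantKernel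
    congr 1
    ext z
    split_ifs <;> simp
  rw [sigmaSq, ← integral_eq_lintegral_of_nonneg_ae
    (Eventually.of_forall fun z => by positivity) (by fun_prop), hdens]
  change ∫ z in sqDisc (ε ^ 2), _ ∂_ = _
  rw [setIntegral_withDensity_eq_setIntegral_toReal_smul
    (((measurable_quadrantKernel α).const_mul _).ennreal_ofReal)
    (Eventually.of_forall fun z => ENNReal.ofReal_lt_top) _ (measurableSet_sqDisc _)]
  simp_rw [ENNReal.toReal_ofReal (mul_nonneg hC.le (quadrantKernel_nonneg α _)), smul_eq_mul,
    mul_assoc]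
  rw [integral_const_mul, setIntegral_sqDisc_quadrantKernel_mul α hε]
  · ring
  · intro z
    simp only [Prod.smul_fst, Prod.smul_snd, smul_eq_mul]
    ring

lemma setIntegral_nuEps {α : ℝ} (hC : 0 < C1 α) {ε h : ℝ} (hε : 0 < ε)
    (hσ : 0 < sigmaEps α ε) (hle : ε ^ 2 / sigmaEps α ε ^ 2 ≤ h ^ 2) :
    ∫ z in {z : ℝ × ℝ | z.1 ^ 2 + z.2 ^ 2 ≤ h ^ 2}, z.1 * z.2 ∂(nuEps α ε) =
      ε ^ (2 - α) / sigmaEps α ε ^ 2 *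
        (C1 α * ∫ z in sqDisc 1, quadrantKernel α z * (z.1 * z.2)) := by
  set s := sigmaEps α ε with hs
  have hdens : nuEps α ε = (volume : Measure (ℝ × ℝ)).withDensity
      fun z => ENNReal.ofReal ((sqDisc ((ε / s) ^ 2)).indicator
        (fun z => C1 α * s ^ (-α) * quadrantKernel α z) z) := by
    unfold nuEps quadrantKernel
    congr 1
    ext z
    simp only [← hs, indicator, sqDisc, mem_ofPred_eq, div_pow, ← and_assoc]
    by_cases h1 : z.1 < 0 ∧ 0 < z.2 <;>
      by_cases h2 : z.1 ^ 2 + z.2 ^ 2 ≤ ε ^ 2 / s ^ 2 <;> simp [h1, h2]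
  have hnonneg : ∀ z, 0 ≤ (sqDisc ((ε / s) ^ 2)).indicator
      (fun z => C1 α * s ^ (-α) * quadrantKernel α z) z := fun z =>
    indicator_nonneg (fun z _ => mul_nonneg (mul_nonneg hC.le (Real.rpow_nonneg hσ.le _))
      (quadrantKernel_nonneg α z)) z
  have hsub : sqDisc ((ε / s) ^ 2) ⊆ sqDisc (h ^ 2) := by
    intro z hz
    simp only [sqDisc, mem_ofPred_eq, div_pow] at hz ⊢
    exact hz.trans hle
  rw [hdens]
  change ∫ z in sqDisc (h ^ 2), _ ∂_ = _
  rw [setIntegral_withDensity_eq_setIntegral_toReal_smul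
    ((((measurable_quadrantKernel α).const_mul _).indicator
      (measurableSet_sqDisc _)).ennreal_ofReal)
    (Eventually.of_forall fun z => ENNReal.ofReal_lt_top) _ (measurableSet_sqDisc _)]
  simp_rw [ENNReal.toReal_ofReal (hnonneg _), smul_eq_mul]
  have hmul : ∀ z : ℝ × ℝ, (sqDisc ((ε / s) ^ 2)).indicator
      (fun z => C1 α * s ^ (-α) * quadrantKernel α z) z * (z.1 * z.2) =
      (sqDisc ((ε / s) ^ 2)).indicator
        (fun z => C1 α * s ^ (-α) * quadrantKernel α z * (z.1 * z.2)) z := fun z =>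
    (indicator_mul_left _ _ fun z : ℝ × ℝ => z.1 * z.2).symm
  simp_rw [hmul]
  rw [setIntegral_indicator (measurableSet_sqDisc _), inter_eq_right.2 hsub]
  simp_rw [mul_assoc (C1 α * s ^ (-α))]
  rw [integral_const_mul,
    setIntegral_sqDisc_quadrantKernel_mul α (div_pos hε hσ), Real.div_rpow hε.le hσ.le]
  · have hpow : s ^ (-α) / s ^ (2 - α) = (s ^ 2)⁻¹ := by
      rw [← Real.rpow_sub hσ, ← Real.rpow_natCast s, ← Real.rpow_neg hσ.le]
      congr 1
      push_cast
      ring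
    rw [div_eq_mul_inv (ε ^ (2 - α)) (s ^ 2), ← hpow]
    ring
  · intro z
    simp only [Prod.smul_fst, Prod.smul_snd, smul_eq_mul]
    ring

lemma quadrantKernel_mul_mul_nonpos (α : ℝ) (z : ℝ × ℝ) :
    quadrantKernel α z * (z.1 * z.2) ≤ 0 := by
  by_cases hz : z.1 < 0 ∧ 0 < z.2
  · exact mul_nonpos_of_nonneg_of_nonpos (quadrantKernel_nonneg α z)
      (mul_nonpos_of_nonpos_of_nonneg hz.1.le hz.2.le)
  · simp [quadrantKernel, hz]

lemma nuEps_eq_zero {α ε : ℝ} (hneg : C1 α * sigmaEps α ε ^ (-α) ≤ 0) : nuEps α ε = 0 := by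
  have hzero : (fun z : ℝ × ℝ =>
      if z.1 < 0 ∧ 0 < z.2 ∧ z.1 ^ 2 + z.2 ^ 2 ≤ ε ^ 2 / sigmaEps α ε ^ 2 then
        ENNReal.ofReal (C1 α * sigmaEps α ε ^ (-α) * (-z.1 + z.2) ^ (-α - 2))
      else 0) = 0 := by
    ext z
    simp only [Pi.zero_apply, ite_eq_right_iff, ENNReal.ofReal_eq_zero]
    exact fun hz => mul_nonpos_of_nonpos_of_nonneg hneg
      (Real.rpow_nonneg (by linarith [hz.1, hz.2.1]) _)
  rw [nuEps, hzero, withDensity_zero]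

/-- For each fixed `h ∈ (0,1)`, the limit
`r = lim_{ε→0⁺} ∫_{x²+y²≤h²} x y dν_ε(x,y)` exists and satisfies `-1/2 ≤ r ≤ 0`. -/
theorem stmt11 (α : ℝ) (hα1 : 1 < α) (hα2 : α < 2) (h : ℝ) (hh0 : 0 < h) (hh1 : h < 1) :
    ∃ r : ℝ, -(1 / 2) ≤ r ∧ r ≤ 0 ∧
      Filter.Tendsto (fun ε : ℝ =>
          ∫ z in {z : ℝ × ℝ | z.1 ^ 2 + z.2 ^ 2 ≤ h ^ 2}, z.1 * z.2 ∂(nuEps α ε))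
        (𝓝[>] (0 : ℝ)) (𝓝 r) := by
  set J := ∫ z in sqDisc 1, quadrantKernel α z * (z.1 ^ 2 + z.2 ^ 2) with hJ
  set K := ∫ z in sqDisc 1, quadrantKernel α z * (z.1 * z.2) with hK
  have hJ0 : 0 ≤ J := integral_nonneg fun z =>
    mul_nonneg (quadrantKernel_nonneg α z) (by positivity)
  by_cases hpos : 0 < C1 α ∧ 0 < J
  · obtain ⟨hC, hJpos⟩ := hpos
    have hint : Integrable (fun z : ℝ × ℝ => quadrantKernel α z * (z.1 ^ 2 + z.2 ^ 2))
        (volume.restrict (sqDisc 1)) := by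
      by_contra hni
      exact hJpos.ne' (integral_undef hni)
    have hσ : ∀ ε : ℝ, 0 < ε → sigmaEps α ε ^ 2 = ε ^ (2 - α) * (C1 α * J) := fun ε hε => by
      rw [sigmaEps, Real.sq_sqrt ENNReal.toReal_nonneg, toReal_sigmaSq hC hε]
    refine ⟨K / J, ?_, ?_, ?_⟩
    · have hbound : -K ≤ 1 / 2 * J := by
        rw [hK, hJ, ← integral_neg, ← integral_const_mul]
        refine integral_mono_of_nonneg (Eventually.of_forall fun z =>
          neg_nonneg.2 (quadrantKernel_mul_mul_nonpos α z)) (hint.const_mul _)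
          (Eventually.of_forall fun z => ?_)
        have := mul_nonneg (quadrantKernel_nonneg α z) (sq_nonneg (z.1 + z.2))
        dsimp only
        linarith
      rw [le_div_iff₀ hJpos]
      linarith
    · exact div_nonpos_of_nonpos_of_nonneg
        (integral_nonpos fun z => quadrantKernel_mul_mul_nonpos α z) hJ0
    · refine tendsto_const_nhds.congr' ?_
      have hlim : Tendsto (fun ε : ℝ => ε ^ α) (𝓝[>] 0) (𝓝 0) := by
        have := (Real.continuousAt_rpow_const 0 α (Or.inr (by linarith))).tendsto
        rw [Real.zero_rpow (by linarith)] at this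
        exact this.mono_left nhdsWithin_le_nhds
      have hsmall : 0 < h ^ 2 * (C1 α * J) := by positivity
      filter_upwards [self_mem_nhdsWithin, hlim.eventually_le_const hsmall] with ε hε hεh
      have hε : 0 < ε := hε
      have hp : 0 < ε ^ (2 - α) := Real.rpow_pos_of_pos hε _
      have hσpos : 0 < sigmaEps α ε := by
        refine (Real.sqrt_nonneg _).lt_of_ne' fun h0 => ?_
        have := hσ ε hε
        rw [sigmaEps, h0] at this
        have : 0 < ε ^ (2 - α) * (C1 α * J) := by positivity
        linarith
      have hsq : ε ^ 2 = ε ^ α * ε ^ (2 - α) := by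
        rw [← Real.rpow_add hε, ← Real.rpow_natCast]
        norm_num
      rw [setIntegral_nuEps hC hε hσpos, hσ ε hε, ← hK]
      · field_simp
      · rw [hσ ε hε, div_le_iff₀ (by positivity), hsq]
        nlinarith [mul_le_mul_of_nonneg_right hεh hp.le]
  · refine ⟨0, by norm_num, le_rfl, tendsto_const_nhds.congr' ?_⟩
    filter_upwards [self_mem_nhdsWithin] with ε hε
    rw [nuEps_eq_zero, Measure.restrict_zero, integral_zero_measure]
    rcases le_or_gt (C1 α) 0 with hC | hC
    · exact mul_nonpos_of_nonpos_of_nonneg hC (Real.rpow_nonneg (Real.sqrt_nonneg _) _)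
    · have hJz : J = 0 := le_antisymm (not_lt.1 fun hJp => hpos ⟨hC, hJp⟩) hJ0
      rw [sigmaEps, toReal_sigmaSq hC hε, ← hJ, hJz]
      simp [Real.zero_rpow (show -α ≠ 0 by linarith)]
end
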